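/- F_0^M(x,y,q) = 1, F_1^M(x,y,q) = x, and for all n ≥ 2, F_n^M(x,y,q) = x·q^{n−1}·F_{n−1}^M(x,y,q) + y·q^{n−2}·F_{n−2}^M(x,y,q), as an identity in the polynomial ring ℤ[x,y,q]. -/

import Mathlib

open Finset MvPolynomial

open scoped Classical

/-- `σ` (a permutation of `[n]` in one-line notation `σ 0, …, σ (n-1)`) contains the
pattern `π` (given by its one-line notation as a function `Fin m → Fin m`) if some
subsequence of `σ` is order isomorphic to `π`. -/
def PermContains {n m : ℕ} (σ : Equiv.Perm (Fin n)) (π : Fin m → Fin m) : Prop :=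
  ∃ f : Fin m → Fin n, (∀ a b : Fin m, a < b → f a < f b) ∧
    ∀ a b : Fin m, σ (f a) < σ (f b) ↔ π a < π b

/-- `σ` avoids the pattern `π`. -/
def PermAvoids {n m : ℕ} (σ : Equiv.Perm (Fin n)) (π : Fin m → Fin m) : Prop :=
  ¬ PermContains σ π

/-- The value `σ i` of the one-line notation of `σ`, as a natural number (0-based). -/
def permVal {n : ℕ} (σ : Equiv.Perm (Fin n)) (i : ℕ) : ℕ :=
  if h : i < n then (σ ⟨i, h⟩ : ℕ) else 0

/-- `inv σ` : the number of inversions, i.e. pairs of positions `i < j` with `σ i > σ j`. -/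
def invStat {n : ℕ} (σ : Equiv.Perm (Fin n)) : ℕ :=
  ((Finset.range n ×ˢ Finset.range n).filter
    fun p => p.1 < p.2 ∧ permVal σ p.2 < permVal σ p.1).card

/-- `maj σ` : the sum of all (1-based) indices `i` with `σ(i) > σ(i+1)`; with 0-based
positions, a descent at positions `i, i+1` contributes `i + 1`. -/
def majStat {n : ℕ} (σ : Equiv.Perm (Fin n)) : ℕ :=
  ∑ i ∈ Finset.range (n - 1), if permVal σ (i + 1) < permVal σ i then i + 1 else 0

/-- The number of ascents of `σ`; for `σ ∈ Sₙ(123,132,213)` (a reverse layered matching)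
this equals `d σ`, the number of doubleton blocks. -/
def ascStat {n : ℕ} (σ : Equiv.Perm (Fin n)) : ℕ :=
  ((Finset.range (n - 1)).filter fun i => permVal σ i < permVal σ (i + 1)).card

/-- The number of descents of `σ`; for `σ ∈ Sₙ(231,312,321)` (a layered matching)
this equals `d σ`, the number of doubleton blocks. -/
def descStat {n : ℕ} (σ : Equiv.Perm (Fin n)) : ℕ :=
  ((Finset.range (n - 1)).filter fun i => permVal σ (i + 1) < permVal σ i).card

/-- `Sₙ(123, 132, 213)` : permutations of `[n]` avoiding `123`, `132` and `213`
(patterns written 0-based). -/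
noncomputable def S123 (n : ℕ) : Finset (Equiv.Perm (Fin n)) :=
  Finset.univ.filter fun σ =>
    PermAvoids σ ![0, 1, 2] ∧ PermAvoids σ ![0, 2, 1] ∧ PermAvoids σ ![1, 0, 2]

/-- `Sₙ(231, 312, 321)` : permutations of `[n]` avoiding `231`, `312` and `321`
(patterns written 0-based). -/
noncomputable def S231 (n : ℕ) : Finset (Equiv.Perm (Fin n)) :=
  Finset.univ.filter fun σ =>
    PermAvoids σ ![1, 2, 0] ∧ PermAvoids σ ![2, 0, 1] ∧ PermAvoids σ ![2, 1, 0]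

/-- `Fₙᴹ(x, y, q) = Σ_{σ ∈ Sₙ(123,132,213)} x^(s σ) * y^(d σ) * q^(maj σ)` in `ℤ[x,y,q]`;
here `x = X 0`, `y = X 1`, `q = X 2`. -/
noncomputable def FM (n : ℕ) : MvPolynomial (Fin 3) ℤ :=
  ∑ σ ∈ S123 n, X 0 ^ (n - 2 * ascStat σ) * X 1 ^ ascStat σ * X 2 ^ majStat σ

theorem permVal_of_lt {n i : ℕ} (σ : Equiv.Perm (Fin n)) (h : i < n) :
    permVal σ i = (σ ⟨i, h⟩ : ℕ) := dif_pos h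

theorem permVal_lt {n i : ℕ} (σ : Equiv.Perm (Fin n)) (h : i < n) : permVal σ i < n := by
  rw [permVal_of_lt σ h]
  exact (σ _).isLt

theorem permVal_inj {n i j : ℕ} (σ : Equiv.Perm (Fin n)) (hi : i < n) (hj : j < n)
    (h : permVal σ i = permVal σ j) : i = j := by
  rw [permVal_of_lt σ hi, permVal_of_lt σ hj] at h
  simpa using σ.injective (Fin.ext h)

theorem exists_permVal_eq {n v : ℕ} (σ : Equiv.Perm (Fin n)) (hv : v < n) :
    ∃ i < n, permVal σ i = v := by
  refine ⟨σ.symm ⟨v, hv⟩, Fin.isLt _, ?_⟩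
  simp [permVal_of_lt]

theorem perm_ext_permVal {n : ℕ} {σ τ : Equiv.Perm (Fin n)}
    (h : ∀ i < n, permVal σ i = permVal τ i) : σ = τ := by
  ext i
  have := h i i.isLt
  rwa [permVal_of_lt, permVal_of_lt] at this

/-- Among the patterns of length three, `123`, `132` and `213` are exactly those whose first
entry is smaller than the last one. -/
theorem mem_S123_iff {n : ℕ} (σ : Equiv.Perm (Fin n)) :
    σ ∈ S123 n ↔ ∀ i k, i + 2 ≤ k → k < n → permVal σ k < permVal σ i := by
  simp only [S123, mem_filter, mem_univ, true_and]
  constructor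
  · rintro ⟨h₁, h₂, h₃⟩ i k hik hk
    by_contra! hlt
    have hi : i < n := by omega
    have hj : i + 1 < n := by omega
    have hne₁ := mt (permVal_inj σ hi hk) (by omega)
    have hne₂ := mt (permVal_inj σ hi hj) (by omega)
    have hne₃ := mt (permVal_inj σ hj hk) (by omega)
    rw [permVal_of_lt σ hi, permVal_of_lt σ hk] at *
    rw [permVal_of_lt σ hj] at *
    have hmono : ∀ a b : Fin 3, a < b →
        (![⟨i, hi⟩, ⟨i + 1, hj⟩, ⟨k, hk⟩] : Fin 3 → Fin n) a
          < (![⟨i, hi⟩, ⟨i + 1, hj⟩, ⟨k, hk⟩] : Fin 3 → Fin n) b := by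
      intro a b
      fin_cases a <;> fin_cases b <;> simp [Fin.lt_def, -Fin.val_fin_lt] <;> omega
    rcases lt_or_gt_of_ne hne₂ with h | h
    · rcases lt_or_gt_of_ne hne₃ with h' | h'
      · refine h₁ ⟨_, hmono, fun a b => ?_⟩
        fin_cases a <;> fin_cases b <;> simp [Fin.lt_def, -Fin.val_fin_lt] <;> omega
      · refine h₂ ⟨_, hmono, fun a b => ?_⟩
        fin_cases a <;> fin_cases b <;> simp [Fin.lt_def, -Fin.val_fin_lt] <;> omega
    · refine h₃ ⟨_, hmono, fun a b => ?_⟩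
      fin_cases a <;> fin_cases b <;> simp [Fin.lt_def, -Fin.val_fin_lt] <;> omega
  · intro h
    have key : ∀ π : Fin 3 → Fin 3, π 0 < π 2 → PermAvoids σ π := by
      rintro π hπ ⟨f, hf, hfπ⟩
      have h₀₁ := hf 0 1 (by decide)
      have h₁₂ := hf 1 2 (by decide)
      have hlt := (hfπ 0 2).2 hπ
      have := h (f 0) (f 2) (by rw [Fin.lt_def] at h₀₁ h₁₂; omega) (f 2).isLt
      rw [permVal_of_lt σ (f 0).isLt, permVal_of_lt σ (f 2).isLt] at this
      exact absurd hlt (not_lt.2 (Fin.le_def.2 this.le))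
    exact ⟨key _ (by decide), key _ (by decide), key _ (by decide)⟩

/-- The skew sum of `τ` with the identity of `Fin k`: an increasing block of length `k`,
smaller than all other entries, is appended at the end of `τ`. -/
def skewAppend {m : ℕ} (τ : Equiv.Perm (Fin m)) (k : ℕ) : Equiv.Perm (Fin (m + k)) :=
  finSumFinEquiv.symm.trans ((Equiv.sumCongr τ (Equiv.refl (Fin k))).trans
    ((Equiv.sumComm _ _).trans (finSumFinEquiv.trans (finCongr (Nat.add_comm k m)))))

theorem permVal_skewAppend_of_lt {m i : ℕ} (τ : Equiv.Perm (Fin m)) (k : ℕ) (hi : i < m) :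
    permVal (skewAppend τ k) i = permVal τ i + k := by
  rw [permVal_of_lt τ hi, permVal_of_lt _ (by omega : i < m + k)]
  have : (⟨i, by omega⟩ : Fin (m + k)) = Fin.castAdd k ⟨i, hi⟩ := rfl
  rw [this]
  simp [skewAppend, -Fin.castAdd_mk, add_comm]

theorem permVal_skewAppend_add {m j : ℕ} (τ : Equiv.Perm (Fin m)) (k : ℕ) (hj : j < k) :
    permVal (skewAppend τ k) (m + j) = j := by
  rw [permVal_of_lt _ (by omega : m + j < m + k)]
  have : (⟨m + j, by omega⟩ : Fin (m + k)) = Fin.natAdd m ⟨j, hj⟩ := rfl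
  rw [this]
  simp [skewAppend, -Fin.natAdd_mk]

theorem skewAppend_injective {m : ℕ} (k : ℕ) :
    Function.Injective fun τ : Equiv.Perm (Fin m) => skewAppend τ k := by
  intro τ τ' h
  refine perm_ext_permVal fun i hi => ?_
  have := congrArg (permVal · i) h
  simpa [permVal_skewAppend_of_lt _ k hi] using this

theorem exists_eq_skewAppend {m k : ℕ} (σ : Equiv.Perm (Fin (m + k)))
    (h : ∀ j < k, permVal σ (m + j) = j) : ∃ τ : Equiv.Perm (Fin m), σ = skewAppend τ k := by
  have hk : ∀ i < m, k ≤ permVal σ i := by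
    intro i hi
    by_contra! hlt
    have := permVal_inj σ (by omega) (by omega) (h _ hlt)
    omega
  let f : Fin m → Fin m := fun i =>
    ⟨permVal σ i - k, by
      have := hk i i.isLt
      have := permVal_lt σ (by omega : (i : ℕ) < m + k)
      omega⟩
  have hf : Function.Injective f := by
    intro i j hij
    have h₁ := hk i i.isLt
    have h₂ := hk j j.isLt
    have h₃ : permVal σ i - k = permVal σ j - k := congrArg Fin.val hij
    exact Fin.ext (permVal_inj σ (by omega) (by omega) (by omega))
  refine ⟨Equiv.ofBijective f (Finite.injective_iff_bijective.1 hf), perm_ext_permVal ?_⟩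
  intro i hi
  rcases lt_or_ge i m with him | him
  · have := hk i him
    rw [permVal_skewAppend_of_lt _ k him, permVal_of_lt _ him, Equiv.ofBijective_apply]
    change _ = permVal σ i - k + k
    omega
  · obtain ⟨j, rfl⟩ := Nat.exists_eq_add_of_le him
    rw [permVal_skewAppend_add _ k (by omega), h j (by omega)]

theorem skewAppend_mem_S123_iff {m k : ℕ} (hk : k ≤ 2) (τ : Equiv.Perm (Fin m)) :
    skewAppend τ k ∈ S123 (m + k) ↔ τ ∈ S123 m := by
  simp only [mem_S123_iff]
  constructor
  · intro h a b hab hb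
    have := h a b hab (by omega)
    rw [permVal_skewAppend_of_lt _ k hb, permVal_skewAppend_of_lt _ k (by omega)] at this
    omega
  · intro h a b hab hb
    have ha : a < m := by omega
    rw [permVal_skewAppend_of_lt _ k ha]
    rcases lt_or_ge b m with hbm | hbm
    · rw [permVal_skewAppend_of_lt _ k hbm]
      have := h a b hab hbm
      omega
    · obtain ⟨j, rfl⟩ := Nat.exists_eq_add_of_le hbm
      rw [permVal_skewAppend_add _ k (by omega)]
      omega

/-- The last block of a reverse layered matching is a singleton or a doubleton. -/
theorem S123_add_two (m : ℕ) :
    S123 (m + 2) = (S123 (m + 1)).image (fun τ => skewAppend τ 1) ∪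
      (S123 m).image (fun τ => skewAppend τ 2) := by
  ext σ
  simp only [mem_union, mem_image]
  constructor
  · intro hσ
    have h := (mem_S123_iff σ).1 hσ
    by_cases h₀ : permVal σ (m + 1) = 0
    · left
      obtain ⟨τ, rfl⟩ := exists_eq_skewAppend (m := m + 1) (k := 1) σ (by
        intro j hj
        obtain rfl : j = 0 := by omega
        exact h₀)
      exact ⟨τ, (skewAppend_mem_S123_iff one_le_two τ).1 hσ, rfl⟩
    · right
      obtain ⟨i, hi, hi₀⟩ := exists_permVal_eq σ (by omega : 0 < m + 2)
      obtain ⟨j, hj, hj₁⟩ := exists_permVal_eq σ (by omega : 1 < m + 2)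
      have him : i = m := by
        have := h i (m + 1)
        have : i ≠ m + 1 := by rintro rfl; exact h₀ hi₀
        omega
      have hjm : j = m + 1 := by
        have := h j (m + 1)
        have : j ≠ i := by rintro rfl; omega
        omega
      subst him hjm
      obtain ⟨τ, rfl⟩ := exists_eq_skewAppend σ (by
        intro j hj
        interval_cases j
        · exact hi₀
        · exact hj₁)
      exact ⟨τ, (skewAppend_mem_S123_iff le_rfl τ).1 hσ, rfl⟩
  · rintro (⟨τ, hτ, rfl⟩ | ⟨τ, hτ, rfl⟩)
    · exact (skewAppend_mem_S123_iff one_le_two τ).2 hτ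
    · exact (skewAppend_mem_S123_iff le_rfl τ).2 hτ

theorem disjoint_image_skewAppend (m : ℕ) :
    Disjoint ((S123 (m + 1)).image (fun τ => skewAppend τ 1))
      ((S123 m).image (fun τ => (skewAppend τ 2 : Equiv.Perm (Fin (m + 1 + 1))))) := by
  simp only [disjoint_left, mem_image]
  rintro _ ⟨τ, -, rfl⟩ ⟨τ', -, h⟩
  have h₁ := permVal_skewAppend_add τ 1 zero_lt_one
  have h₂ := permVal_skewAppend_add τ' 2 one_lt_two
  have := congrArg (permVal · (m + 1)) h
  simp only [add_zero] at h₁ this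
  omega

theorem majStat_skewAppend_one {m : ℕ} (τ : Equiv.Perm (Fin m)) :
    majStat (skewAppend τ 1) = majStat τ + m := by
  cases m with
  | zero => rfl
  | succ p =>
    have h₁ := permVal_skewAppend_add τ 1 zero_lt_one
    have h₀ := permVal_skewAppend_of_lt τ 1 (by omega : p < p + 1)
    simp only [majStat, Nat.add_sub_cancel, sum_range_succ]
    congr 1
    · refine sum_congr rfl fun i hi => ?_
      rw [mem_range] at hi
      simp [permVal_skewAppend_of_lt τ 1 (by omega : i < p + 1),
        permVal_skewAppend_of_lt τ 1 (by omega : i + 1 < p + 1)]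
    · rw [if_pos]
      simp only [add_zero] at h₁
      omega

theorem ascStat_skewAppend_one {m : ℕ} (τ : Equiv.Perm (Fin m)) :
    ascStat (skewAppend τ 1) = ascStat τ := by
  cases m with
  | zero => rfl
  | succ p =>
    have h₁ := permVal_skewAppend_add τ 1 zero_lt_one
    simp only [add_zero] at h₁
    simp only [ascStat, card_filter, Nat.add_sub_cancel, sum_range_succ, h₁, not_lt_zero,
      if_false, add_zero]
    refine sum_congr rfl fun i hi => ?_
    rw [mem_range] at hi
    simp [permVal_skewAppend_of_lt τ 1 (by omega : i < p + 1),
      permVal_skewAppend_of_lt τ 1 (by omega : i + 1 < p + 1)]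

theorem majStat_skewAppend_two {m : ℕ} (τ : Equiv.Perm (Fin m)) :
    majStat (skewAppend τ 2) = majStat τ + m := by
  have h₀ := permVal_skewAppend_add τ 2 zero_lt_two
  have h₁ := permVal_skewAppend_add τ 2 one_lt_two
  simp only [add_zero] at h₀
  have hlast : ¬ permVal (skewAppend τ 2) (m + 1) < permVal (skewAppend τ 2) m := by omega
  have hmaj : majStat (skewAppend τ 2) = ∑ i ∈ range m,
      if permVal (skewAppend τ 2) (i + 1) < permVal (skewAppend τ 2) i then i + 1 else 0 := by
    rw [majStat, show m + 2 - 1 = m + 1 by omega, sum_range_succ, if_neg hlast, add_zero]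
  rw [hmaj]
  cases m with
  | zero => rfl
  | succ p =>
    have hp := permVal_skewAppend_of_lt τ 2 (by omega : p < p + 1)
    simp only [majStat, Nat.add_sub_cancel, sum_range_succ]
    congr 1
    · refine sum_congr rfl fun i hi => ?_
      rw [mem_range] at hi
      simp [permVal_skewAppend_of_lt τ 2 (by omega : i < p + 1),
        permVal_skewAppend_of_lt τ 2 (by omega : i + 1 < p + 1)]
    · rw [if_pos]
      omega

theorem ascStat_skewAppend_two {m : ℕ} (τ : Equiv.Perm (Fin m)) :
    ascStat (skewAppend τ 2) = ascStat τ + 1 := by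
  have h₀ := permVal_skewAppend_add τ 2 zero_lt_two
  have h₁ := permVal_skewAppend_add τ 2 one_lt_two
  simp only [add_zero] at h₀
  have hlast : permVal (skewAppend τ 2) m < permVal (skewAppend τ 2) (m + 1) := by omega
  simp only [ascStat, card_filter]
  rw [show m + 2 - 1 = m + 1 by omega, sum_range_succ, if_pos hlast]
  congr 1
  cases m with
  | zero => rfl
  | succ p =>
    simp only [Nat.add_sub_cancel, sum_range_succ, h₀, not_lt_zero, if_false, add_zero]
    refine sum_congr rfl fun i hi => ?_
    rw [mem_range] at hi
    simp [permVal_skewAppend_of_lt τ 2 (by omega : i < p + 1),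
      permVal_skewAppend_of_lt τ 2 (by omega : i + 1 < p + 1)]

theorem two_mul_ascStat_le (n : ℕ) : ∀ σ ∈ S123 n, 2 * ascStat σ ≤ n := by
  induction n using Nat.twoStepInduction with
  | zero => simp [ascStat]
  | one => simp [ascStat]
  | more m ih₀ ih₁ =>
    intro σ hσ
    simp only [S123_add_two, mem_union, mem_image] at hσ
    rcases hσ with ⟨τ, hτ, rfl⟩ | ⟨τ, hτ, rfl⟩
    · have := ih₁ τ hτ
      have := ascStat_skewAppend_one τ
      omega
    · have := ih₀ τ hτ
      have := ascStat_skewAppend_two τ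
      omega

theorem FM_add_two (m : ℕ) :
    FM (m + 2) = X 0 * X 2 ^ (m + 1) * FM (m + 1) + X 1 * X 2 ^ m * FM m := by
  rw [FM, S123_add_two, sum_union (disjoint_image_skewAppend m),
    sum_image (skewAppend_injective 1).injOn, sum_image (skewAppend_injective 2).injOn,
    FM, FM, mul_sum, mul_sum]
  refine congrArg₂ (· + ·) ?_ ?_
  · refine sum_congr rfl fun τ hτ => ?_
    have := two_mul_ascStat_le _ τ hτ
    have hexp : m + 2 - 2 * ascStat τ = m + 1 - 2 * ascStat τ + 1 := by omega
    rw [ascStat_skewAppend_one, majStat_skewAppend_one, hexp]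
    ring
  · refine sum_congr rfl fun τ _ => ?_
    have hexp : m + 2 - 2 * (ascStat τ + 1) = m - 2 * ascStat τ := by omega
    rw [ascStat_skewAppend_two, majStat_skewAppend_two, hexp]
    ring

theorem S123_eq_univ {n : ℕ} (hn : n ≤ 2) : S123 n = univ := by
  ext σ
  simp only [mem_S123_iff, mem_univ, iff_true]
  omega

/-- `F₀ᴹ = 1`, `F₁ᴹ = x`, and for `n ≥ 2`,
`Fₙᴹ = x q^(n-1) F_{n-1}ᴹ + y q^(n-2) F_{n-2}ᴹ` in `ℤ[x,y,q]`. -/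
theorem stmt3 :
    FM 0 = 1 ∧ FM 1 = X 0 ∧
      ∀ n : ℕ, 2 ≤ n →
        FM n = X 0 * X 2 ^ (n - 1) * FM (n - 1) + X 1 * X 2 ^ (n - 2) * FM (n - 2) := by
  refine ⟨?_, ?_, fun n hn => ?_⟩
  · simp [FM, S123_eq_univ, ascStat, majStat]
  · simp [FM, S123_eq_univ, ascStat, majStat]
  · obtain ⟨m, rfl⟩ := Nat.exists_eq_add_of_le' hn
    exact FM_add_two m
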